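/- Let p be a prime with p > 3. If p ≡ 1 (mod 3), then Σ_{k=0}^{p−1} C(2k,k)·C(3k,k) / (27^k (3k + 2)) ≡ 1 / ( 2·C(2(p−1)/3, (p−1)/3) ) (mod p²). If p ≡ 2 (mod 3), then Σ_{k=0}^{p−1} C(2k,k)·C(3k,k) / (27^k (3k + 1)) ≡ (1 + 2p) / ( 2·C(2(p−2)/3, (p−2)/3) ) (mod p²). -/

import Mathlib

/-- A rational number is a `p`-integer if its denominator (in lowest terms)
is not divisible by `p`. -/
def isPInt (p : ℕ) (x : ℚ) : Prop := ¬ p ∣ x.den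

/-- For `p`-integers `u, v`, `u ≡ v (mod p^k)` means `(u - v)/p^k` is a `p`-integer. -/
def pCong (p k : ℕ) (u v : ℚ) : Prop := isPInt p ((u - v) / (p : ℚ) ^ k)

/-! ### Arithmetic of `p`-integers -/

theorem isPInt_iff {p : ℕ} {x : ℚ} :
    isPInt p x ↔ ∃ a b : ℤ, ¬ (p : ℤ) ∣ b ∧ x = a / b := by
  constructor
  · intro h
    exact ⟨x.num, x.den, by exact_mod_cast h, by simp [Rat.num_div_den]⟩
  · rintro ⟨a, b, hb, rfl⟩ h
    refine hb ((Int.natCast_dvd_natCast.2 h).trans ?_)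
    rw [← Rat.divInt_eq_div]
    exact Rat.den_dvd a b

theorem isPInt_intCast {p : ℕ} (hp : p.Prime) (a : ℤ) : isPInt p a := by
  simp [isPInt, hp.one_lt.ne']

theorem isPInt_inv_intCast {p : ℕ} {b : ℤ} (hb : ¬ (p : ℤ) ∣ b) : isPInt p (b : ℚ)⁻¹ :=
  isPInt_iff.2 ⟨1, b, hb, by simp⟩

theorem isPInt_inv_natCast {p b : ℕ} (hb : ¬ p ∣ b) : isPInt p (b : ℚ)⁻¹ := by
  simpa using isPInt_inv_intCast (b := b) (by exact_mod_cast hb)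

/-- The ring of `p`-integers. -/
def pIntegers (p : ℕ) (hp : p.Prime) : Subring ℚ where
  carrier := {x | isPInt p x}
  mul_mem' := by
    intro x y hx hy
    obtain ⟨a, b, hb, rfl⟩ := isPInt_iff.1 hx
    obtain ⟨c, d, hd, rfl⟩ := isPInt_iff.1 hy
    refine isPInt_iff.2 ⟨a * c, b * d, (Nat.prime_iff_prime_int.1 hp).not_dvd_mul hb hd, ?_⟩
    push_cast
    rw [div_mul_div_comm]
  one_mem' := by simpa using isPInt_intCast hp 1
  add_mem' := by
    intro x y hx hy
    obtain ⟨a, b, hb, rfl⟩ := isPInt_iff.1 hx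
    obtain ⟨c, d, hd, rfl⟩ := isPInt_iff.1 hy
    refine isPInt_iff.2
      ⟨a * d + b * c, b * d, (Nat.prime_iff_prime_int.1 hp).not_dvd_mul hb hd, ?_⟩
    have hb0 : (b : ℚ) ≠ 0 := by rintro h; simp_all
    have hd0 : (d : ℚ) ≠ 0 := by rintro h; simp_all
    push_cast
    rw [div_add_div _ _ hb0 hd0]
  zero_mem' := by simpa using isPInt_intCast hp 0
  neg_mem' := by
    intro x hx
    obtain ⟨a, b, hb, rfl⟩ := isPInt_iff.1 hx
    exact isPInt_iff.2 ⟨-a, b, hb, by push_cast; ring⟩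

section Congruences

variable {p : ℕ} {hp : p.Prime} {k : ℕ} {u v w u' v' : ℚ}

theorem pCong_iff (hp : p.Prime) :
    pCong p k u v ↔ ∃ c ∈ pIntegers p hp, u = v + (p : ℚ) ^ k * c := by
  have hp0 : (p : ℚ) ^ k ≠ 0 := pow_ne_zero _ (by exact_mod_cast hp.ne_zero)
  constructor
  · intro h
    exact ⟨_, h, by field_simp; ring⟩
  · rintro ⟨c, hc, rfl⟩
    have : (v + (p : ℚ) ^ k * c - v) / (p : ℚ) ^ k = c := by field_simp; ring
    rw [pCong, this]
    exact hc

theorem pCong_refl (hp : p.Prime) (u : ℚ) : pCong p k u u :=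
  (pCong_iff hp).2 ⟨0, zero_mem _, by ring⟩

theorem pCong_trans (hp : p.Prime) (h : pCong p k u v) (h' : pCong p k v w) :
    pCong p k u w := by
  obtain ⟨c, hc, rfl⟩ := (pCong_iff hp).1 h
  obtain ⟨d, hd, rfl⟩ := (pCong_iff hp).1 h'
  exact (pCong_iff hp).2 ⟨d + c, add_mem hd hc, by ring⟩

theorem pCong_add (hp : p.Prime) (h : pCong p k u v) (h' : pCong p k u' v') :
    pCong p k (u + u') (v + v') := by
  obtain ⟨c, hc, rfl⟩ := (pCong_iff hp).1 h
  obtain ⟨d, hd, rfl⟩ := (pCong_iff hp).1 h'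
  exact (pCong_iff hp).2 ⟨c + d, add_mem hc hd, by ring⟩

theorem pCong_mul_left (hw : w ∈ pIntegers p hp) (h : pCong p k u v) :
    pCong p k (w * u) (w * v) := by
  obtain ⟨c, hc, rfl⟩ := (pCong_iff hp).1 h
  exact (pCong_iff hp).2 ⟨w * c, mul_mem hw hc, by ring⟩

theorem mem_pIntegers_of_pCong (h : pCong p k u v) (hv : v ∈ pIntegers p hp) :
    u ∈ pIntegers p hp := by
  obtain ⟨c, hc, rfl⟩ := (pCong_iff hp).1 h
  exact add_mem hv (mul_mem (pow_mem (natCast_mem _ p) k) hc)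

theorem pCong_mul (hu' : u' ∈ pIntegers p hp) (hv : v ∈ pIntegers p hp)
    (h : pCong p k u v) (h' : pCong p k u' v') : pCong p k (u * u') (v * v') := by
  refine pCong_trans hp ?_ (pCong_mul_left hv h')
  simpa only [mul_comm _ u'] using pCong_mul_left hu' h

theorem pCong_sum (hp : p.Prime) {ι : Type*} (s : Finset ι) (f g : ι → ℚ)
    (h : ∀ i ∈ s, pCong p k (f i) (g i)) : pCong p k (∑ i ∈ s, f i) (∑ i ∈ s, g i) := by
  classical
  induction s using Finset.induction_on with
  | empty => exact pCong_refl hp _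
  | insert i s hi ih =>
    rw [Finset.sum_insert hi, Finset.sum_insert hi]
    exact pCong_add hp (h i (by simp)) (ih fun j hj => h j (by simp [hj]))

/-- To first order, a product of factors close to `1` is a sum. -/
theorem pCong_prod_one_add {ι : Type*} (s : Finset ι) (f : ι → ℚ)
    (h : ∀ i ∈ s, f i ∈ pIntegers p hp) :
    pCong p 2 (∏ i ∈ s, (1 + p * f i)) (1 + p * ∑ i ∈ s, f i) := by
  classical
  induction s using Finset.induction_on with
  | empty => simpa using pCong_refl hp _
  | insert i s hi ih =>
    rw [Finset.prod_insert hi, Finset.sum_insert hi]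
    have hs : ∀ j ∈ s, f j ∈ pIntegers p hp := fun j hj => h j (by simp [hj])
    have hfi : f i ∈ pIntegers p hp := h i (by simp)
    refine pCong_trans hp
      (pCong_mul_left (add_mem (one_mem _) (mul_mem (natCast_mem _ p) hfi)) (ih hs)) ?_
    exact (pCong_iff hp).2 ⟨f i * ∑ j ∈ s, f j, mul_mem hfi (sum_mem hs), by ring⟩

theorem inv_mem_pIntegers {b : ℕ} (hb : ¬ p ∣ b) : (b : ℚ)⁻¹ ∈ pIntegers p hp :=
  isPInt_inv_natCast hb

theorem inv_intCast_mem_pIntegers {b : ℤ} (hb : ¬ (p : ℤ) ∣ b) :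
    (b : ℚ)⁻¹ ∈ pIntegers p hp :=
  isPInt_inv_intCast hb

theorem inv_mem_pIntegers_of_lt {b : ℕ} (h0 : 0 < b) (hb : b < p) :
    (b : ℚ)⁻¹ ∈ pIntegers p hp :=
  inv_mem_pIntegers fun h => (Nat.le_of_dvd h0 h).not_gt hb

theorem inv_ofNat_mem_pIntegers (hp3 : 3 < p) :
    (2 : ℚ)⁻¹ ∈ pIntegers p hp ∧ (3 : ℚ)⁻¹ ∈ pIntegers p hp :=
  ⟨by exact_mod_cast inv_mem_pIntegers_of_lt (hp := hp) (b := 2) (by lia) (by lia),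
    by exact_mod_cast inv_mem_pIntegers_of_lt (hp := hp) (b := 3) (by lia) (by lia)⟩

theorem not_dvd_three_mul_sub (hp : p.Prime) (hp3 : 3 < p) {b : ℤ} (c : ℤ)
    (hb : ¬ (p : ℤ) ∣ b) : ¬ (p : ℤ) ∣ 3 * b - c * p := fun h =>
  have h3 : ¬ (p : ℤ) ∣ 3 := fun h => by have := Int.le_of_dvd (by lia) h; lia
  (Nat.prime_iff_prime_int.1 hp).not_dvd_mul h3 hb ((dvd_sub_left (dvd_mul_left _ c)).1 h)

theorem sub_mul_third_ne_zero (hp : p.Prime) (hp3 : 3 < p) {b : ℤ} (c : ℤ)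
    (hb : ¬ (p : ℤ) ∣ b) : (b : ℚ) - c * (p / 3) ≠ 0 := by
  intro h
  refine not_dvd_three_mul_sub hp hp3 c hb ?_
  have : ((3 * b - c * p : ℤ) : ℚ) = 0 := by push_cast; linear_combination 3 * h
  rw [Int.cast_eq_zero.1 this]
  exact dvd_zero _

theorem inv_sub_mul_third_mem (hp3 : 3 < p) {b : ℤ} (c : ℤ) (hb : ¬ (p : ℤ) ∣ b) :
    ((b : ℚ) - c * (p / 3))⁻¹ ∈ pIntegers p hp := by
  have e : ((b : ℚ) - c * (p / 3)) = ((3 * b - c * p : ℤ) : ℚ) / 3 := by push_cast; ring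
  rw [e, inv_div, div_eq_mul_inv]
  exact mul_mem (ofNat_mem _ 3)
    (inv_intCast_mem_pIntegers (not_dvd_three_mul_sub hp hp3 c hb))

theorem third_mem_pIntegers (hp3 : 3 < p) : (p / 3 : ℚ) ∈ pIntegers p hp := by
  rw [div_eq_mul_inv]
  exact mul_mem (natCast_mem _ p) (inv_ofNat_mem_pIntegers hp3).2

theorem not_dvd_of_pos_of_lt {b : ℤ} (h0 : 0 < b) (hb : b < p) : ¬ (p : ℤ) ∣ b := fun h =>
  (Int.le_of_dvd h0 h).not_gt hb

end Congruences

/-! ### The hypergeometric sum -/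

/-- `(-a)_k (a + 1)_k / k!²`, that is, the product of the generalised binomial coefficients
`a` over `k` and `-1 - a` over `k`. -/
def hyp (a : ℚ) (k : ℕ) : ℚ := ∏ i ∈ Finset.range k, (i - a) * (i + 1 + a) / (i + 1) ^ 2

/-- The truncated series `∑ hyp a k / (k + 1 + a)`. -/
def hypSum (a : ℚ) (n : ℕ) : ℚ := ∑ k ∈ Finset.range n, hyp a k / (k + 1 + a)

theorem hyp_succ (a : ℚ) (k : ℕ) :
    hyp a (k + 1) = hyp a k * ((k - a) * (k + 1 + a) / (k + 1) ^ 2) :=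
  Finset.prod_range_succ _ _

theorem hyp_sub_one {a : ℚ} (ha : ∀ k : ℕ, a + k ≠ 0) (k : ℕ) :
    hyp (a - 1) k = hyp a k * ((a - k) / (a + k)) := by
  induction k with
  | zero => have := ha 0; simp_all [hyp]
  | succ k ih =>
    have h1 := ha k
    have h2 := ha (k + 1)
    push_cast at h2
    rw [hyp_succ, hyp_succ, ih]
    push_cast
    field_simp
    ring

/-- Zeilberger's recurrence for the truncated series. -/
theorem hypSum_rec {a : ℚ} (ha : ∀ k : ℕ, a + k ≠ 0) (n : ℕ) :
    2 * (2 * a + 1) * hypSum a n + a * hypSum (a - 1) n =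
      -(n ^ 2 * hyp a n * (5 * a + 3 * n) / (a * (a + n) ^ 2)) := by
  induction n with
  | zero => simp [hypSum]
  | succ n ih =>
    have h0 : a ≠ 0 := by simpa using ha 0
    have h1 := ha n
    have h2 : a + (n + 1) ≠ 0 := by simpa using ha (n + 1)
    have h3 : (n : ℚ) + 1 + a ≠ 0 := by rwa [add_comm]
    have h4 : (n : ℚ) + 1 + (a - 1) ≠ 0 := by convert h1 using 1; ring
    have e1 : hypSum a (n + 1) = hypSum a n + hyp a n / (n + 1 + a) :=
      Finset.sum_range_succ _ _
    have e2 : hypSum (a - 1) (n + 1) =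
        hypSum (a - 1) n + hyp a n * ((a - n) / (a + n)) / (n + a) := by
      rw [← hyp_sub_one ha, show (n : ℚ) + a = n + 1 + (a - 1) by ring]
      exact Finset.sum_range_succ _ _
    rw [e1, e2, hyp_succ, show 2 * (2 * a + 1) * (hypSum a n + hyp a n / (n + 1 + a)) +
      a * (hypSum (a - 1) n + hyp a n * ((a - n) / (a + n)) / (n + a)) =
      (2 * (2 * a + 1) * hypSum a n + a * hypSum (a - 1) n) + hyp a n *
      (2 * (2 * a + 1) / (n + 1 + a) + a * ((a - n) / (a + n)) / (n + a)) by ring, ih]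
    rw [add_comm (n : ℚ) a, show (n : ℚ) + 1 + a = a + (n + 1) by ring]
    push_cast
    field_simp
    ring

/-- The truncated series at `-x` has nearly trivial terms. -/
theorem hyp_neg_succ (x : ℚ) (k : ℕ) :
    hyp (-x) (k + 1) = x * (k + 1 - x) / (k + 1) ^ 2 *
      ∏ i ∈ Finset.range k, (1 - x ^ 2 / (i + 1) ^ 2) := by
  induction k with
  | zero => simp [hyp, ← sub_eq_add_neg]
  | succ k ih =>
    rw [hyp_succ, ih, Finset.prod_range_succ]
    push_cast
    field_simp
    ring

theorem choose_mul_choose_eq (k : ℕ) :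
    ((2 * k).choose k : ℚ) * (3 * k).choose k = 27 ^ k * hyp (-1 / 3) k := by
  have h (k : ℕ) : ((2 * k).choose k : ℚ) * (3 * k).choose k =
      (3 * k).factorial / k.factorial ^ 3 := by
    rw [Nat.cast_choose ℚ (show k ≤ 2 * k by lia), Nat.cast_choose ℚ (show k ≤ 3 * k by lia),
      show 2 * k - k = k by lia, show 3 * k - k = 2 * k by lia]
    have := Nat.factorial_ne_zero k
    have := Nat.factorial_ne_zero (2 * k)
    field_simp
  induction k with
  | zero => simp [hyp]
  | succ k ih =>
    rw [hyp_succ, pow_succ, show (27 : ℚ) ^ k * 27 * (hyp (-1 / 3) k *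
      ((k - -1 / 3) * (k + 1 + -1 / 3) / (k + 1) ^ 2)) = 27 ^ k * hyp (-1 / 3) k *
      (27 * ((k - -1 / 3) * (k + 1 + -1 / 3) / (k + 1) ^ 2)) by ring, ← ih, h, h,
      show 3 * (k + 1) = 3 * k + 1 + 1 + 1 by ring, Nat.factorial_succ, Nat.factorial_succ,
      Nat.factorial_succ, Nat.factorial_succ]
    have := Nat.factorial_ne_zero k
    push_cast
    field_simp
    ring

theorem hyp_symm (a : ℚ) (k : ℕ) : hyp (-1 - a) k = hyp a k :=
  Finset.prod_congr rfl fun _ _ => by ring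

section Prime

variable {p : ℕ} {hp : p.Prime}

theorem inv_factorial_mem_pIntegers {n : ℕ} (hn : n < p) :
    (n.factorial : ℚ)⁻¹ ∈ pIntegers p hp :=
  inv_mem_pIntegers fun h => ((hp.dvd_factorial).1 h).not_gt hn

theorem prod_mul_inv_factorial_mem {f : ℕ → ℚ} (hf : ∀ i, f i ∈ pIntegers p hp) {m : ℕ}
    (hm : m < p) {c : ℚ} (hc : c ∈ pIntegers p hp) (hfm : f m = p * c) :
    (∏ i ∈ Finset.range p, f i) * (p.factorial : ℚ)⁻¹ ∈ pIntegers p hp := by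
  have hp0 : (p : ℚ) ≠ 0 := by exact_mod_cast hp.ne_zero
  rw [← Finset.mul_prod_erase _ _ (Finset.mem_range.2 hm), hfm,
    ← Nat.mul_factorial_pred hp.ne_zero, Nat.cast_mul, mul_inv,
    show p * c * (∏ i ∈ (Finset.range p).erase m, f i) *
      ((p : ℚ)⁻¹ * ((p - 1).factorial : ℚ)⁻¹) =
      c * (∏ i ∈ (Finset.range p).erase m, f i) * ((p - 1).factorial : ℚ)⁻¹ by field_simp]
  exact mul_mem (mul_mem hc (prod_mem fun i _ => hf i))
    (inv_factorial_mem_pIntegers (Nat.sub_lt hp.pos one_pos))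

theorem hyp_mem_pIntegers (hp3 : 3 < p) {m : ℕ} (hm : m < p) :
    hyp (m - p / 3) p ∈ pIntegers p hp := by
  have h3 := (inv_ofNat_mem_pIntegers (hp := hp) hp3).2
  have hx := third_mem_pIntegers (hp := hp) hp3
  have h : hyp (m - p / 3) p =
      ((∏ i ∈ Finset.range p, ((i : ℚ) - (m - p / 3))) * (p.factorial : ℚ)⁻¹) *
      ((∏ i ∈ Finset.range p, ((i : ℚ) + 1 + (m - p / 3))) * (p.factorial : ℚ)⁻¹) := by
    rw [← Finset.prod_range_add_one_eq_factorial]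
    push_cast
    rw [hyp, Finset.prod_div_distrib, Finset.prod_mul_distrib, Finset.prod_pow]
    ring
  rw [h]
  refine mul_mem
    (prod_mul_inv_factorial_mem (m := m)
      (fun i => sub_mem (natCast_mem _ i) (sub_mem (natCast_mem _ m) hx)) hm h3 (by ring))
    (prod_mul_inv_factorial_mem (m := p - 1 - m)
      (fun i => add_mem (add_mem (natCast_mem _ i) (one_mem _)) (sub_mem (natCast_mem _ m) hx))
      (by lia) (mul_mem (ofNat_mem _ 2) h3) ?_)
  rw [Nat.cast_sub (by lia), Nat.cast_sub (by lia)]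
  push_cast
  ring

theorem hypSum_step (hp : p.Prime) (hp3 : 3 < p) {m : ℕ} (hm : 3 * (m + 1) < p) :
    pCong p 2 (hypSum ((m + 1 : ℕ) - p / 3) p)
      (-((m + 1 - p / 3) / (2 * (2 * m + 3 - 2 * (p / 3)))) * hypSum (m - p / 3) p) := by
  set a : ℚ := m + 1 - p / 3 with ha
  have h2 := (inv_ofNat_mem_pIntegers (hp := hp) hp3).1
  have hx := third_mem_pIntegers (hp := hp) hp3
  have ham : a ∈ pIntegers p hp := sub_mem (add_mem (natCast_mem _ m) (one_mem _)) hx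
  have hd0 := not_dvd_of_pos_of_lt (p := p) (b := m + 1) (by lia) (by lia)
  have hdp : ¬ (p : ℤ) ∣ m + 1 + p := fun h => hd0 ((Int.dvd_add_left (dvd_refl _)).1 h)
  have hd3 := not_dvd_of_pos_of_lt (p := p) (b := 2 * m + 3) (by lia) (by lia)
  have e0 : ((m + 1 : ℤ) : ℚ) - (1 : ℤ) * (p / 3) = a := by push_cast; ring
  have ep : ((m + 1 + p : ℤ) : ℚ) - (1 : ℤ) * (p / 3) = a + p := by push_cast; ring
  have e3 : ((2 * m + 3 : ℤ) : ℚ) - (2 : ℤ) * (p / 3) = 2 * a + 1 := by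
    push_cast; rw [ha]; ring
  have u0 := e0 ▸ inv_sub_mul_third_mem (hp := hp) hp3 1 hd0
  have up := ep ▸ inv_sub_mul_third_mem (hp := hp) hp3 1 hdp
  have u3 := e3 ▸ inv_sub_mul_third_mem (hp := hp) hp3 2 hd3
  have n0 := e0 ▸ sub_mul_third_ne_zero hp hp3 1 hd0
  have np := ep ▸ sub_mul_third_ne_zero hp hp3 1 hdp
  have n3 := e3 ▸ sub_mul_third_ne_zero hp hp3 2 hd3
  have hak (k : ℕ) : a + k ≠ 0 := by
    intro h
    have h' : 3 * (m + 1 + k) = p := by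
      have : (3 * (m + 1 + k) : ℚ) = p := by linear_combination 3 * h
      exact_mod_cast this
    exact hp3.ne ((Nat.prime_dvd_prime_iff_eq Nat.prime_three hp).1 ⟨_, h'.symm⟩)
  have hrec := hypSum_rec hak p
  have hU := hyp_mem_pIntegers (hp := hp) hp3 (m := m + 1) (by lia)
  rw [show ((m + 1 : ℕ) : ℚ) - p / 3 = a by push_cast; rfl] at hU ⊢
  rw [show a - 1 = m - p / 3 by rw [ha]; ring] at hrec
  rw [show 2 * (m : ℚ) + 3 - 2 * (p / 3) = 2 * a + 1 by rw [ha]; ring]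
  refine (pCong_iff hp).2
    ⟨-(hyp a p * (5 * a + 3 * p) * a⁻¹ * (a + p)⁻¹ ^ 2 * 2⁻¹ * (2 * a + 1)⁻¹), ?_, ?_⟩
  · exact neg_mem (mul_mem (mul_mem (mul_mem (mul_mem (mul_mem hU
      (add_mem (mul_mem (ofNat_mem _ 5) ham) (mul_mem (ofNat_mem _ 3) (natCast_mem _ p)))) u0)
      (pow_mem up 2)) h2) u3)
  · have : hypSum a p = (2 * (2 * a + 1) * hypSum a p) / (2 * (2 * a + 1)) := by
      field_simp
    rw [this, eq_sub_of_add_eq hrec]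
    field_simp
    ring

theorem hyp_neg_third_pCong (hp : p.Prime) (hp3 : 3 < p) {k : ℕ} (hk : k < p) :
    pCong p 2 (∏ i ∈ Finset.range k, (1 - (p / 3 : ℚ) ^ 2 / (i + 1) ^ 2)) 1 := by
  have h3 := (inv_ofNat_mem_pIntegers (hp := hp) hp3).2
  have hi {i : ℕ} (hi : i ∈ Finset.range k) : ((i : ℚ) + 1)⁻¹ ∈ pIntegers p hp := by
    exact_mod_cast inv_mem_pIntegers_of_lt (b := i + 1) (by lia) (by grind)
  have h (i : ℕ) (h' : i ∈ Finset.range k) : -(3 : ℚ)⁻¹ ^ 2 * ((i : ℚ) + 1)⁻¹ ^ 2 ∈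
      pIntegers p hp := mul_mem (neg_mem (pow_mem h3 2)) (pow_mem (hi h') 2)
  have e : ∏ i ∈ Finset.range k, (1 - (p / 3 : ℚ) ^ 2 / (i + 1) ^ 2) =
      ∏ i ∈ Finset.range k, (1 + p * (p * (-(3 : ℚ)⁻¹ ^ 2 * ((i : ℚ) + 1)⁻¹ ^ 2))) :=
    Finset.prod_congr rfl fun i _ => by field_simp; ring
  rw [e]
  refine pCong_trans hp (pCong_prod_one_add (hp := hp) _ _
    fun i hi => mul_mem (natCast_mem _ p) (h i hi)) ((pCong_iff hp).2 ⟨_, sum_mem h, ?_⟩)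
  rw [← Finset.mul_sum]
  ring

theorem sum_inv_mul_succ (x : ℚ) (q : ℕ) :
    ∑ k ∈ Finset.range q, x * (((k : ℚ) + 1)⁻¹ * ((k : ℚ) + 2)⁻¹) = x * q / (q + 1) := by
  induction q with
  | zero => simp
  | succ q ih =>
    rw [Finset.sum_range_succ, ih]
    push_cast
    field_simp
    ring

theorem hypSum_neg_third (hp : p.Prime) (hp3 : 3 < p) :
    pCong p 2 (hypSum (-(p / 3)) p) (1 / 2 + p / 3) := by
  obtain ⟨q, rfl⟩ : ∃ q, p = q + 2 := ⟨p - 2, by lia⟩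
  set p := q + 2 with hpq
  set x : ℚ := p / 3 with hxp
  obtain ⟨h2, h3⟩ := inv_ofNat_mem_pIntegers (hp := hp) hp3
  have hx : x ∈ pIntegers p hp := third_mem_pIntegers hp3
  have hinv {b : ℕ} (h0 : 0 < b) (hb : b < p) : (b : ℚ)⁻¹ ∈ pIntegers p hp :=
    inv_mem_pIntegers_of_lt h0 hb
  have hmid : pCong p 2 (∑ k ∈ Finset.range q, hyp (-x) (k + 1) / ((k + 1 : ℕ) + 1 + -x))
      (∑ k ∈ Finset.range q, x * (((k : ℚ) + 1)⁻¹ * ((k : ℚ) + 2)⁻¹)) := by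
    refine pCong_sum hp _ _ _ fun k hk => ?_
    rw [Finset.mem_range] at hk
    have hd := not_dvd_of_pos_of_lt (p := p) (b := k + 2) (by lia) (by lia)
    have e : ((k + 2 : ℤ) : ℚ) - (1 : ℤ) * (p / 3) = k + 2 - x := by push_cast; ring
    have u := e ▸ inv_sub_mul_third_mem (hp := hp) hp3 1 hd
    have n := e ▸ sub_mul_third_ne_zero hp hp3 1 hd
    have u1 : ((k : ℚ) + 1)⁻¹ ∈ pIntegers p hp := by
      exact_mod_cast hinv (b := k + 1) (by lia) (by lia)
    have u2 : ((k : ℚ) + 2)⁻¹ ∈ pIntegers p hp := by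
      exact_mod_cast hinv (b := k + 2) (by lia) (by lia)
    have hW := hyp_neg_third_pCong hp hp3 (k := k) (by lia)
    have hw : x * (k + 1 - x) * ((k : ℚ) + 1)⁻¹ ^ 2 * ((k : ℚ) + 2 - x)⁻¹ ∈ pIntegers p hp :=
      mul_mem (mul_mem (mul_mem hx (sub_mem (add_mem (natCast_mem _ k) (one_mem _)) hx))
        (pow_mem u1 2)) u
    have e' : hyp (-x) (k + 1) / ((k + 1 : ℕ) + 1 + -x) =
        x * (k + 1 - x) * ((k : ℚ) + 1)⁻¹ ^ 2 * ((k : ℚ) + 2 - x)⁻¹ *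
          ∏ i ∈ Finset.range k, (1 - x ^ 2 / (i + 1) ^ 2) := by
      rw [hyp_neg_succ, show ((k + 1 : ℕ) : ℚ) + 1 + -x = k + 2 - x by push_cast; ring]
      field_simp
    rw [e']
    refine pCong_trans hp (pCong_mul_left hw hW) ((pCong_iff hp).2
      ⟨-(3⁻¹ ^ 2 * ((k : ℚ) + 1)⁻¹ ^ 2 * ((k : ℚ) + 2 - x)⁻¹ * ((k : ℚ) + 2)⁻¹),
      neg_mem (mul_mem (mul_mem (mul_mem (pow_mem h3 2) (pow_mem u1 2)) u) u2), ?_⟩)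
    rw [show (p : ℚ) = 3 * x by rw [hxp]; ring]
    field_simp
    ring
  rw [sum_inv_mul_succ] at hmid
  have uq : ((q : ℚ) + 1)⁻¹ ∈ pIntegers p hp := by
    exact_mod_cast hinv (b := q + 1) (by lia) (by lia)
  have hlast : pCong p 2 (hyp (-x) (q + 1) / ((q + 1 : ℕ) + 1 + -x))
      ((q + 1 - x) * 2⁻¹ * ((q : ℚ) + 1)⁻¹ ^ 2 * 1) := by
    have e' : hyp (-x) (q + 1) / ((q + 1 : ℕ) + 1 + -x) =
        (q + 1 - x) * 2⁻¹ * ((q : ℚ) + 1)⁻¹ ^ 2 *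
          ∏ i ∈ Finset.range q, (1 - x ^ 2 / (i + 1) ^ 2) := by
      have hx0 : x ≠ 0 := by rw [hxp]; positivity
      rw [hyp_neg_succ, show ((q + 1 : ℕ) : ℚ) + 1 + -x = 2 * x by
        rw [hxp, hpq]; push_cast; ring]
      field_simp
    rw [e']
    exact pCong_mul_left (mul_mem (mul_mem (sub_mem (add_mem (natCast_mem _ q) (one_mem _)) hx)
      h2) (pow_mem uq 2)) (hyp_neg_third_pCong hp hp3 (by lia))
  have hsum : hypSum (-x) p = (∑ k ∈ Finset.range q, hyp (-x) (k + 1) /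
      ((k + 1 : ℕ) + 1 + -x) + 1 / (1 - x)) + hyp (-x) (q + 1) / ((q + 1 : ℕ) + 1 + -x) := by
    rw [hypSum, hpq, Finset.sum_range_succ, Finset.sum_range_succ']
    simp [hyp, ← sub_eq_add_neg]
  have hd := not_dvd_of_pos_of_lt (p := p) (b := 1) (by lia) (by lia)
  have e : ((1 : ℤ) : ℚ) - (1 : ℤ) * (p / 3) = 1 - x := by push_cast; ring
  have u := e ▸ inv_sub_mul_third_mem (hp := hp) hp3 1 hd
  have n := e ▸ sub_mul_third_ne_zero hp hp3 1 hd
  rw [hsum]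
  refine pCong_trans hp (pCong_add hp (pCong_add hp hmid (pCong_refl hp _)) hlast) ?_
  have hq : (q : ℚ) + 1 = 3 * x - 1 := by rw [hxp, hpq]; push_cast; ring
  have hq0 : 3 * x - 1 ≠ 0 := by rw [← hq]; positivity
  rw [hq] at uq ⊢
  rw [show (q : ℚ) = 3 * x - 2 by linear_combination hq]
  refine (pCong_iff hp).2
    ⟨3⁻¹ ^ 2 * (15 * x - 7) * 2⁻¹ * (1 - x)⁻¹ * (3 * x - 1)⁻¹ ^ 2,
    mul_mem (mul_mem (mul_mem (mul_mem (pow_mem h3 2) (sub_mem (mul_mem (ofNat_mem _ 15) hx)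
      (ofNat_mem _ 7))) h2) u) (pow_mem uq 2), ?_⟩
  rw [show (p : ℚ) = 3 * x by rw [hxp]; ring]
  obtain ⟨y, hy⟩ : ∃ y, y = 3 * x - 1 := ⟨_, rfl⟩
  rw [← hy] at hq0 ⊢
  field_simp
  rw [hy]
  ring

theorem hypSum_pCong_prod (hp : p.Prime) (hp3 : 3 < p) {m : ℕ} (hm : 3 * m < p) :
    pCong p 2 (hypSum (m - p / 3) p) ((∏ j ∈ Finset.range m,
      -((j + 1 - p / 3 : ℚ) / (2 * (2 * j + 3 - 2 * (p / 3))))) * hypSum (-(p / 3)) p) := by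
  induction m with
  | zero => simpa using pCong_refl hp _
  | succ m ih =>
    have hd := not_dvd_of_pos_of_lt (p := p) (b := 2 * m + 3) (by lia) (by lia)
    have e : ((2 * m + 3 : ℤ) : ℚ) - (2 : ℤ) * (p / 3) = 2 * m + 3 - 2 * (p / 3) := by
      push_cast; ring
    have u := e ▸ inv_sub_mul_third_mem (hp := hp) hp3 2 hd
    have hw : -((m + 1 - p / 3 : ℚ) / (2 * (2 * m + 3 - 2 * (p / 3)))) ∈ pIntegers p hp := by
      rw [div_eq_mul_inv, mul_inv]
      exact neg_mem (mul_mem (sub_mem (add_mem (natCast_mem _ m) (one_mem _))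
        (third_mem_pIntegers hp3)) (mul_mem (inv_ofNat_mem_pIntegers hp3).1 u))
    refine pCong_trans hp (hypSum_step hp hp3 hm) ?_
    rw [Finset.prod_range_succ_comm, mul_assoc]
    exact pCong_mul_left hw (ih (by lia))

/-- The first order correction in the comparison with a central binomial coefficient. -/
theorem prod_mul_centralBinom (hp : p.Prime) (hp3 : 3 < p) {m : ℕ} (hm : 3 * m < p) :
    (∏ j ∈ Finset.range m, -((j + 1 - p / 3 : ℚ) / (2 * (2 * j + 3 - 2 * (p / 3))))) *
      ((-1) ^ m * ((2 * m + 1) * m.centralBinom)) =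
    ∏ j ∈ Finset.range m,
      (1 + p * (-(3⁻¹ * (((j : ℚ) + 1)⁻¹ * (2 * j + 3 - 2 * (p / 3) : ℚ)⁻¹)))) := by
  induction m with
  | zero => simp
  | succ m ih =>
    have hd := not_dvd_of_pos_of_lt (p := p) (b := 2 * m + 3) (by lia) (by lia)
    have e : ((2 * m + 3 : ℤ) : ℚ) - (2 : ℤ) * (p / 3) = 2 * m + 3 - 2 * (p / 3) := by
      push_cast; ring
    have n := e ▸ sub_mul_third_ne_zero hp hp3 2 hd
    have hC : ((m : ℚ) + 1) * (m + 1).centralBinom = 2 * (2 * m + 1) * m.centralBinom := by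
      exact_mod_cast Nat.succ_mul_centralBinom_succ m
    have hC' : ((m + 1).centralBinom : ℚ) = 2 * (2 * m + 1) * m.centralBinom / (m + 1) := by
      rw [← hC]; field_simp
    rw [Finset.prod_range_succ, Finset.prod_range_succ, ← ih (by lia), hC']
    generalize ∏ j ∈ Finset.range m, (_ : ℚ) = P
    generalize hx : (p : ℚ) / 3 = x at n ⊢
    rw [show (p : ℚ) = 3 * x by rw [← hx]; ring]
    obtain ⟨y, hy⟩ : ∃ y, y = 2 * (m : ℚ) + 3 - 2 * x := ⟨_, rfl⟩
    rw [← hy] at n ⊢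
    push_cast
    field_simp
    rw [hy]
    ring

theorem sum_inv_mul_inv (n : ℕ) :
    ∑ j ∈ Finset.range n, (((j : ℚ) + 1)⁻¹ * (2 * j + 3 : ℚ)⁻¹) =
      2 - 2 * ∑ i ∈ Finset.range (n + 1), ((n : ℚ) + i + 1)⁻¹ := by
  have h (n : ℕ) : ∑ j ∈ Finset.range n, (((j : ℚ) + 1)⁻¹ * (2 * j + 3 : ℚ)⁻¹) =
      2 - 2 * (∑ i ∈ Finset.range (n + (n + 1)), ((i : ℚ) + 1)⁻¹ -
        ∑ i ∈ Finset.range n, ((i : ℚ) + 1)⁻¹) := by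
    induction n with
    | zero => simp
    | succ n ih =>
      rw [Finset.sum_range_succ, ih, show n + 1 + (n + 1 + 1) = n + (n + 1) + 1 + 1 by ring,
        Finset.sum_range_succ _ (n + (n + 1) + 1), Finset.sum_range_succ _ (n + (n + 1)),
        Finset.sum_range_succ _ n]
      push_cast
      rw [show (n : ℚ) + (n + 1) + 1 = 2 * (n + 1) by ring,
        show 2 * ((n : ℚ) + 1) + 1 = 2 * n + 3 by ring]
      field_simp
      ring
  rw [h, Finset.sum_range_add]
  push_cast
  ring

/-- The sum of the inverses of a symmetric range of residues vanishes modulo `p`. -/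
theorem sum_inv_symm_pCong (hp : p.Prime) (hp3 : 3 < p) {n L : ℕ} (h : L + 2 * n + 1 = p) :
    pCong p 1 (∑ i ∈ Finset.range L, ((n : ℚ) + i + 1)⁻¹) 0 := by
  have hu {i : ℕ} (hi : i ∈ Finset.range L) : ((n : ℚ) + i + 1)⁻¹ ∈ pIntegers p hp := by
    exact_mod_cast inv_mem_pIntegers_of_lt (b := n + i + 1) (by lia) (by grind)
  have hv {i : ℕ} (hi : i ∈ Finset.range L) :
      ((n : ℚ) + (L - 1 - i : ℕ) + 1)⁻¹ ∈ pIntegers p hp :=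
    hu (by grind)
  refine (pCong_iff hp).2 ⟨2⁻¹ * ∑ i ∈ Finset.range L,
    ((n : ℚ) + i + 1)⁻¹ * ((n : ℚ) + (L - 1 - i : ℕ) + 1)⁻¹,
    mul_mem (inv_ofNat_mem_pIntegers hp3).1 (sum_mem fun i hi => mul_mem (hu hi) (hv hi)), ?_⟩
  have h1 := Finset.sum_range_reflect (fun i : ℕ => ((n : ℚ) + i + 1)⁻¹) L
  have h2 : ∑ i ∈ Finset.range L, ((n : ℚ) + i + 1)⁻¹ +
      ∑ i ∈ Finset.range L, ((n : ℚ) + (L - 1 - i : ℕ) + 1)⁻¹ =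
      p * ∑ i ∈ Finset.range L, ((n : ℚ) + i + 1)⁻¹ * ((n : ℚ) + (L - 1 - i : ℕ) + 1)⁻¹ := by
    rw [← Finset.sum_add_distrib, Finset.mul_sum]
    refine Finset.sum_congr rfl fun i hi => ?_
    have hp' : (p : ℚ) = (n + i + 1) + (n + (L - 1 - i : ℕ) + 1) := by
      rw [Finset.mem_range] at hi
      exact_mod_cast (by lia : p = (n + i + 1) + (n + (L - 1 - i) + 1))
    rw [hp']
    field_simp
    ring
  linear_combination (h2 - h1) / 2

theorem inv_centralBinom_mem_pIntegers {n : ℕ} (hn : 2 * n < p) :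
    (n.centralBinom : ℚ)⁻¹ ∈ pIntegers p hp := by
  refine inv_mem_pIntegers fun hd => hn.not_ge ((hp.dvd_factorial).1 (hd.trans ?_))
  rw [Nat.centralBinom_eq_two_mul_choose, ← Nat.choose_mul_factorial_mul_factorial
    (show n ≤ 2 * n by lia), mul_assoc]
  exact dvd_mul_right _ _

theorem hypSum_pCong (hp : p.Prime) (hp3 : 3 < p) {n : ℕ} (hn : 3 * n < p) {h : ℚ}
    (hh : h ∈ pIntegers p hp)
    (hsum : pCong p 1 (∑ i ∈ Finset.range (n + 1), ((n : ℚ) + i + 1)⁻¹) h) :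
    pCong p 2 (hypSum (n - p / 3) p)
      ((-1) ^ n * (((2 * n + 1 : ℕ) : ℚ)⁻¹ * (n.centralBinom : ℚ)⁻¹) *
        ((1 + p * (-3⁻¹ * (2 - 2 * h))) * (1 / 2 + p / 3))) := by
  obtain ⟨h2, h3⟩ := inv_ofNat_mem_pIntegers (hp := hp) hp3
  have hx := third_mem_pIntegers (hp := hp) hp3
  have hhalf : (1 / 2 + p / 3 : ℚ) ∈ pIntegers p hp :=
    add_mem (by simpa using h2) hx
  have hC : (n.centralBinom : ℚ)⁻¹ ∈ pIntegers p hp :=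
    inv_centralBinom_mem_pIntegers (by lia)
  have hn1 : ((2 * n + 1 : ℕ) : ℚ)⁻¹ ∈ pIntegers p hp :=
    inv_mem_pIntegers_of_lt (by lia) (by lia)
  have hA : (-1) ^ n * (((2 * n + 1 : ℕ) : ℚ)⁻¹ * (n.centralBinom : ℚ)⁻¹) ∈ pIntegers p hp :=
    mul_mem (pow_mem (neg_mem (one_mem _)) n) (mul_mem hn1 hC)
  have hu {j : ℕ} (hj : j ∈ Finset.range n) :
      ((j : ℚ) + 1)⁻¹ ∈ pIntegers p hp ∧ (2 * j + 3 : ℚ)⁻¹ ∈ pIntegers p hp ∧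
      (2 * j + 3 - 2 * (p / 3) : ℚ)⁻¹ ∈ pIntegers p hp ∧
      (2 * j + 3 - 2 * (p / 3) : ℚ) ≠ 0 := by
    rw [Finset.mem_range] at hj
    have hd := not_dvd_of_pos_of_lt (p := p) (b := 2 * j + 3) (by lia) (by lia)
    have e : ((2 * j + 3 : ℤ) : ℚ) - (2 : ℤ) * (p / 3) = 2 * j + 3 - 2 * (p / 3) := by
      push_cast; ring
    exact ⟨by exact_mod_cast inv_mem_pIntegers_of_lt (b := j + 1) (by lia) (by lia),
      by exact_mod_cast inv_mem_pIntegers_of_lt (b := 2 * j + 3) (by lia) (by lia),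
      e ▸ inv_sub_mul_third_mem (hp := hp) hp3 2 hd, e ▸ sub_mul_third_ne_zero hp hp3 2 hd⟩
  have hv : pCong p 1 (∑ j ∈ Finset.range n,
      (-(3⁻¹ * (((j : ℚ) + 1)⁻¹ * (2 * j + 3 - 2 * (p / 3) : ℚ)⁻¹)))) (-3⁻¹ * (2 - 2 * h)) := by
    have h1 : pCong p 1 (∑ j ∈ Finset.range n,
        (-(3⁻¹ * (((j : ℚ) + 1)⁻¹ * (2 * j + 3 - 2 * (p / 3) : ℚ)⁻¹))))
        (∑ j ∈ Finset.range n, -3⁻¹ * (((j : ℚ) + 1)⁻¹ * (2 * j + 3 : ℚ)⁻¹)) := by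
      refine pCong_sum hp _ _ _ fun j hj => ?_
      obtain ⟨u1, u3, ux, nx⟩ := hu hj
      refine (pCong_iff hp).2 ⟨-(3⁻¹ * ((j : ℚ) + 1)⁻¹ * (2 * 3⁻¹) *
        (2 * j + 3 - 2 * (p / 3) : ℚ)⁻¹ * (2 * j + 3 : ℚ)⁻¹), neg_mem (mul_mem (mul_mem (mul_mem
        (mul_mem h3 u1) (mul_mem (ofNat_mem _ 2) h3)) ux) u3), ?_⟩
      generalize hx : (p : ℚ) / 3 = x at nx ⊢
      rw [show (p : ℚ) = 3 * x by rw [← hx]; ring]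
      obtain ⟨y, hy⟩ : ∃ y, y = 2 * (j : ℚ) + 3 - 2 * x := ⟨_, rfl⟩
      rw [← hy] at nx ⊢
      field_simp
      rw [hy]
      ring
    rw [← Finset.mul_sum, sum_inv_mul_inv] at h1
    refine pCong_trans hp h1 (pCong_mul_left (neg_mem h3) ?_)
    simpa [sub_eq_add_neg] using pCong_add hp (pCong_refl hp 2)
      (pCong_mul_left (neg_mem (ofNat_mem (pIntegers p hp) 2)) hsum)
  have hprod : pCong p 2 (∏ j ∈ Finset.range n,
      (1 + p * (-(3⁻¹ * (((j : ℚ) + 1)⁻¹ * (2 * j + 3 - 2 * (p / 3) : ℚ)⁻¹)))))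
      (1 + p * (-3⁻¹ * (2 - 2 * h))) := by
    refine pCong_trans hp (pCong_prod_one_add (hp := hp) _ _ fun j hj => neg_mem (mul_mem h3
      (mul_mem (hu hj).1 (hu hj).2.2.1))) ?_
    obtain ⟨c, hc, e⟩ := (pCong_iff hp).1 hv
    exact (pCong_iff hp).2 ⟨c, hc, by rw [e]; ring⟩
  have hbase := hypSum_neg_third hp hp3
  have hκ : (1 + p * (-3⁻¹ * (2 - 2 * h)) : ℚ) ∈ pIntegers p hp :=
    add_mem (one_mem _) (mul_mem (natCast_mem _ p) (mul_mem (neg_mem h3)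
      (sub_mem (ofNat_mem _ 2) (mul_mem (ofNat_mem _ 2) hh))))
  refine pCong_trans hp (hypSum_pCong_prod hp hp3 hn) ?_
  have e : ∏ j ∈ Finset.range n, -((j + 1 - p / 3 : ℚ) / (2 * (2 * j + 3 - 2 * (p / 3)))) =
      (-1) ^ n * (((2 * n + 1 : ℕ) : ℚ)⁻¹ * (n.centralBinom : ℚ)⁻¹) * ∏ j ∈ Finset.range n,
      (1 + p * (-(3⁻¹ * (((j : ℚ) + 1)⁻¹ * (2 * j + 3 - 2 * (p / 3) : ℚ)⁻¹)))) := by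
    have hC0 : (n.centralBinom : ℚ) ≠ 0 := by exact_mod_cast n.centralBinom_ne_zero
    have hs : ((-1 : ℚ) ^ n) * (-1) ^ n = 1 := by rw [← mul_pow]; simp
    rw [← prod_mul_centralBinom hp hp3 hn]
    generalize ∏ j ∈ Finset.range n, (_ : ℚ) = P
    push_cast
    field_simp
    linear_combination -P * hs
  rw [e, mul_assoc]
  exact pCong_mul_left hA (pCong_mul (mem_pIntegers_of_pCong hbase hhalf) hκ hprod hbase)

end Prime

theorem stmt5 (p : ℕ) (hp : p.Prime) (hp3 : 3 < p) :
    (p % 3 = 1 →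
      pCong p 2
        (∑ k ∈ Finset.range p,
          ((2 * k).choose k : ℚ) * ((3 * k).choose k : ℚ) / (27 ^ k * (3 * (k : ℚ) + 2)))
        (1 / (2 * ((2 * (p - 1) / 3).choose ((p - 1) / 3) : ℚ)))) ∧
    (p % 3 = 2 →
      pCong p 2
        (∑ k ∈ Finset.range p,
          ((2 * k).choose k : ℚ) * ((3 * k).choose k : ℚ) / (27 ^ k * (3 * (k : ℚ) + 1)))
        ((1 + 2 * (p : ℚ)) / (2 * ((2 * (p - 2) / 3).choose ((p - 2) / 3) : ℚ)))) := by
  obtain ⟨h2, h3⟩ := inv_ofNat_mem_pIntegers (hp := hp) hp3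
  have hodd : Odd p := hp.odd_of_ne_two (by lia)
  have hC (n : ℕ) (hn : 3 * n < p) : (n.centralBinom : ℚ)⁻¹ ∈ pIntegers p hp :=
    inv_centralBinom_mem_pIntegers (by lia)
  constructor
  · intro hmod
    obtain ⟨n, hn⟩ : ∃ n, p = 3 * n + 1 := ⟨p / 3, by lia⟩
    have hpn : (p : ℚ) = 3 * n + 1 := by exact_mod_cast hn
    have hu : ((2 * n + 1 : ℕ) : ℚ)⁻¹ ∈ pIntegers p hp :=
      inv_mem_pIntegers_of_lt (by lia) (by lia)
    have hharm : pCong p 1 (∑ i ∈ Finset.range (n + 1), ((n : ℚ) + i + 1)⁻¹) (0 + 3) := by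
      rw [Finset.sum_range_succ]
      refine pCong_add hp (sum_inv_symm_pCong hp hp3 (by lia)) ((pCong_iff hp).2
        ⟨-(2 * ((2 * n + 1 : ℕ) : ℚ)⁻¹), neg_mem (mul_mem (ofNat_mem _ 2) hu), ?_⟩)
      rw [hpn, show (n : ℚ) + n + 1 = 2 * n + 1 by ring]
      push_cast
      field_simp
      ring
    have key := pCong_mul_left h3 (hypSum_pCong hp hp3 (by lia)
      (add_mem (zero_mem _) (ofNat_mem _ 3)) hharm)
    have hsum : ∑ k ∈ Finset.range p,
        ((2 * k).choose k : ℚ) * ((3 * k).choose k : ℚ) / (27 ^ k * (3 * (k : ℚ) + 2)) =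
        3⁻¹ * hypSum (n - p / 3) p := by
      rw [show (n - p / 3 : ℚ) = -1 / 3 by rw [hpn]; ring, hypSum, Finset.mul_sum]
      refine Finset.sum_congr rfl fun k _ => ?_
      rw [choose_mul_choose_eq, show (k : ℚ) + 1 + -1 / 3 = (3 * k + 2) / 3 by ring]
      field_simp
    have hbinom : (2 * (p - 1) / 3).choose ((p - 1) / 3) = n.centralBinom := by
      rw [Nat.centralBinom_eq_two_mul_choose, show 2 * (p - 1) / 3 = 2 * n by lia,
        show (p - 1) / 3 = n by lia]
    have heven : Even n := by grind
    rw [hsum, hbinom]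
    refine pCong_trans hp key ((pCong_iff hp).2 ⟨4 * 3⁻¹ ^ 3 * ((2 * n + 1 : ℕ) : ℚ)⁻¹ *
      (n.centralBinom : ℚ)⁻¹, mul_mem (mul_mem (mul_mem (ofNat_mem _ 4) (pow_mem h3 3)) hu)
      (hC n (by lia)), ?_⟩)
    have hC0 : (n.centralBinom : ℚ) ≠ 0 := by exact_mod_cast n.centralBinom_ne_zero
    rw [heven.neg_one_pow, hpn]
    push_cast
    field_simp
    ring
  · intro hmod
    obtain ⟨n, hn⟩ : ∃ n, p = 3 * n + 2 := ⟨p / 3, by lia⟩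
    have hpn : (p : ℚ) = 3 * n + 2 := by exact_mod_cast hn
    have hu : ((2 * n + 1 : ℕ) : ℚ)⁻¹ ∈ pIntegers p hp :=
      inv_mem_pIntegers_of_lt (by lia) (by lia)
    have key := pCong_mul_left h3 (hypSum_pCong hp hp3 (by lia)
      (zero_mem _) (sum_inv_symm_pCong hp hp3 (n := n) (by lia)))
    have hsum : ∑ k ∈ Finset.range p,
        ((2 * k).choose k : ℚ) * ((3 * k).choose k : ℚ) / (27 ^ k * (3 * (k : ℚ) + 1)) =
        3⁻¹ * hypSum (n - p / 3) p := by
      rw [show (n - p / 3 : ℚ) = -1 - -1 / 3 by rw [hpn]; ring, hypSum, Finset.mul_sum]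
      refine Finset.sum_congr rfl fun k _ => ?_
      rw [choose_mul_choose_eq, hyp_symm,
        show (k : ℚ) + 1 + (-1 - -1 / 3) = (3 * k + 1) / 3 by ring]
      field_simp
    have hbinom : (2 * (p - 2) / 3).choose ((p - 2) / 3) = n.centralBinom := by
      rw [Nat.centralBinom_eq_two_mul_choose, show 2 * (p - 2) / 3 = 2 * n by lia,
        show (p - 2) / 3 = n by lia]
    have hoddn : Odd n := by grind
    rw [hsum, hbinom]
    refine pCong_trans hp key ((pCong_iff hp).2 ⟨-(16 * 3⁻¹ ^ 3 * ((2 * n + 1 : ℕ) : ℚ)⁻¹ *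
      (n.centralBinom : ℚ)⁻¹), neg_mem (mul_mem (mul_mem (mul_mem (ofNat_mem _ 16) (pow_mem h3 3)) hu)
      (hC n (by lia))), ?_⟩)
    have hC0 : (n.centralBinom : ℚ) ≠ 0 := by exact_mod_cast n.centralBinom_ne_zero
    rw [hoddn.neg_one_pow, hpn]
    push_cast
    field_simp
    ring
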